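/- (Derivatives of the Marcum Q-function.) Let m > 0 be real. For every fixed b > 0, the map a ↦ Q_m(a,b) is differentiable on (0,∞) with ∂Q_m(a,b)/∂a = (b^m/a^{m−1})·e^{−(a²+b²)/2}·I_m(a·b); and for every fixed a > 0, the map b ↦ Q_m(a,b) is differentiable on (0,∞) with ∂Q_m(a,b)/∂b = −(b^m/a^{m−1})·e^{−(a²+b²)/2}·I_{m−1}(a·b). -/

import Mathlib

open MeasureTheory ProbabilityTheory Real
open scoped ENNReal NNReal BigOperators RealInnerProductSpace

noncomputable section

/-- The modified Bessel function of the first kind,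
`I_ν(x) = ∑_{k ≥ 0} (x/2)^{ν+2k} / (k! · Γ(ν+k+1))`. -/
def besselI (ν x : ℝ) : ℝ :=
  ∑' k : ℕ, (x / 2) ^ (ν + 2 * (k : ℝ)) / ((k.factorial : ℝ) * Real.Gamma (ν + (k : ℝ) + 1))

/-- The (generalized) Marcum Q-function `Q_m(a,b)`. -/
def marcumQ (m a b : ℝ) : ℝ :=
  if a = 0 then
    ∫ t in Set.Ioi b, t ^ (2 * m - 1) / (2 ^ (m - 1) * Real.Gamma m) * Real.exp (-(t ^ 2) / 2)
  else
    ∫ t in Set.Ioi b,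
      t ^ m / a ^ (m - 1) * Real.exp (-(a ^ 2 + t ^ 2) / 2) * besselI (m - 1) (a * t)

def hS (m x : ℝ) : ℝ := ∑' k : ℕ, x ^ k / ((k.factorial : ℝ) * Real.Gamma (m + k))

lemma hS_coef_bound (m : ℝ) (hm : 0 < m) (ε : ℝ) (hε : 0 < ε) :
    ∃ C > 0, ∀ k : ℕ, 1 / Real.Gamma (m + k) ≤ C * ε ^ k := by
  have hs : Summable (fun k : ℕ => (1 / ε) ^ k / Real.Gamma (m + k)) := by
    apply summable_of_ratio_test_tendsto_lt_one (l := 0) (by norm_num)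
    · refine Filter.Eventually.of_forall fun k => ?_
      have : 0 < Real.Gamma (m + k) := Real.Gamma_pos_of_pos (by positivity)
      positivity
    · have h1 : Filter.Tendsto (fun k : ℕ => (1 / ε) * (m + (k : ℝ))⁻¹) Filter.atTop (nhds ((1 / ε) * 0)) := by
        apply Filter.Tendsto.const_mul
        apply Filter.Tendsto.comp tendsto_inv_atTop_zero
        exact Filter.tendsto_atTop_add_const_left _ _ tendsto_natCast_atTop_atTop
      rw [mul_zero] at h1
      refine h1.congr fun k => ?_
      have hk : 0 < m + (k : ℝ) := by positivity
      have : 0 < Real.Gamma (m + k) := Real.Gamma_pos_of_pos hk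
      have h2 : Real.Gamma (m + ((k + 1 : ℕ) : ℝ)) = (m + k) * Real.Gamma (m + k) := by
        rw [← Real.Gamma_add_one hk.ne']; push_cast; ring_nf
      rw [h2, Real.norm_of_nonneg (by positivity), Real.norm_of_nonneg (by positivity), pow_succ]
      field_simp
  obtain ⟨C, hC⟩ := hs.tendsto_atTop_zero.bddAbove_range
  refine ⟨max C 1, by positivity, fun k => ?_⟩
  have h := hC ⟨k, rfl⟩
  have : 0 < Real.Gamma (m + k) := Real.Gamma_pos_of_pos (by positivity)
  have h3 : 1 / Real.Gamma (m + k) = ((1 / ε) ^ k / Real.Gamma (m + k)) * ε ^ k := by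
    rw [one_div_pow]
    field_simp
  rw [h3]
  gcongr
  exact h.trans (le_max_left _ _)

lemma hS_summable (m : ℝ) (hm : 0 < m) (x : ℝ) :
    Summable (fun k : ℕ => x ^ k / ((k.factorial : ℝ) * Real.Gamma (m + k))) := by
  obtain ⟨C, hC, h⟩ := hS_coef_bound m hm 1 one_pos
  refine Summable.of_norm_bounded (g := fun k : ℕ => C * (|x| ^ k / k.factorial))
    ((Real.summable_pow_div_factorial _).mul_left C) fun k => ?_
  have : 0 < Real.Gamma (m + k) := Real.Gamma_pos_of_pos (by positivity)
  have := h k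
  rw [norm_div, norm_pow, Real.norm_eq_abs, Real.norm_of_nonneg (by positivity)]
  calc _ = 1 / Real.Gamma (m + k) * (|x| ^ k / k.factorial) := by field_simp
    _ ≤ _ := by gcongr; simpa using this

lemma hS_nonneg (m : ℝ) (hm : 0 < m) (x : ℝ) (hx : 0 ≤ x) : 0 ≤ hS m x := by
  refine tsum_nonneg fun k => ?_
  have : 0 < Real.Gamma (m + k) := Real.Gamma_pos_of_pos (by positivity)
  positivity

lemma hS_bound (m : ℝ) (hm : 0 < m) (ε : ℝ) (hε : 0 < ε) :
    ∃ C > 0, ∀ x ≥ 0, hS m x ≤ C * Real.exp (ε * x) := by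
  obtain ⟨C, hC, h⟩ := hS_coef_bound m hm ε hε
  refine ⟨C, hC, fun x hx => ?_⟩
  have he : HasSum (fun k : ℕ => C * ((ε * x) ^ k / k.factorial)) (C * Real.exp (ε * x)) := by
    rw [Real.exp_eq_exp_ℝ]
    exact (NormedSpace.expSeries_div_hasSum_exp (ε * x)).mul_left C
  refine hasSum_le (fun k => ?_) (hS_summable m hm x).hasSum he
  have : 0 < Real.Gamma (m + k) := Real.Gamma_pos_of_pos (by positivity)
  calc _ = 1 / Real.Gamma (m + k) * (x ^ k / k.factorial) := by field_simp
    _ ≤ (C * ε ^ k) * (x ^ k / k.factorial) := by gcongr; exact h k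
    _ = _ := by rw [mul_pow]; ring

lemma hS_shift_term (m : ℝ) (y : ℝ) (k : ℕ) :
    (((k + 1 : ℕ) : ℝ) * y ^ (k + 1 - 1)) / (((k + 1).factorial : ℝ) * Real.Gamma (m + (k + 1 : ℕ)))
      = y ^ k / ((k.factorial : ℝ) * Real.Gamma (m + 1 + k)) := by
  rw [Nat.factorial_succ, Nat.add_sub_cancel]
  push_cast
  rw [show m + (k + 1 : ℝ) = m + 1 + k by ring, mul_assoc, mul_div_mul_left _ _ (by positivity)]

lemma hS_deriv (m : ℝ) (hm : 0 < m) (x : ℝ) : HasDerivAt (hS m) (hS (m + 1) x) x := by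
  have hsum : ∀ y : ℝ, Summable (fun k : ℕ => ((k : ℝ) * y ^ (k - 1)) / ((k.factorial : ℝ) * Real.Gamma (m + k))) := by
    intro y
    rw [← summable_nat_add_iff 1]
    refine (hS_summable (m + 1) (by positivity) y).congr fun k => ?_
    exact (hS_shift_term m y k).symm
  have key := hasDerivAt_tsum_of_isPreconnected (t := Metric.ball (0 : ℝ) (|x| + 1))
    (g := fun (k : ℕ) (y : ℝ) => y ^ k / ((k.factorial : ℝ) * Real.Gamma (m + k)))
    (g' := fun (k : ℕ) (y : ℝ) => ((k : ℝ) * y ^ (k - 1)) / ((k.factorial : ℝ) * Real.Gamma (m + k)))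
    (y₀ := 0) (y := x) (hsum (|x| + 1)) Metric.isOpen_ball
    (convex_ball _ _).isPreconnected (fun k y _ => (hasDerivAt_pow k y).div_const _)
    (fun k y hy => ?_) (by simp; positivity) (hS_summable m hm 0) (by simp)
  · refine key.congr_deriv ?_
    rw [(hsum x).tsum_eq_zero_add]
    simp only [Nat.cast_zero, zero_mul, zero_div, zero_add]
    exact tsum_congr fun k => hS_shift_term m x k
  · have : 0 < Real.Gamma (m + k) := Real.Gamma_pos_of_pos (by positivity)
    have hy' : |y| ≤ |x| + 1 := by
      rw [mem_ball_zero_iff, Real.norm_eq_abs] at hy; exact hy.le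
    rw [norm_div, norm_mul, norm_pow, Real.norm_eq_abs y, Real.norm_of_nonneg (by positivity),
      Real.norm_of_nonneg (by positivity)]
    gcongr

lemma hS_rec (m : ℝ) (hm : 0 < m) (x : ℝ) : hS m x = m * hS (m + 1) x + x * hS (m + 2) x := by
  have h1 := hS_summable m hm x
  have h2 := hS_summable (m + 1) (by positivity) x
  have h3 := hS_summable (m + 2) (by positivity) x
  have h4 : HasSum (fun k : ℕ => (k : ℝ) * (x ^ k / ((k.factorial : ℝ) * Real.Gamma (m + 1 + k)))) (x * hS (m + 2) x) := by
    rw [← hasSum_nat_add_iff' 1]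
    simp only [Finset.range_one, Finset.sum_singleton, Nat.cast_zero, zero_mul, sub_zero]
    refine (h3.hasSum.mul_left x).congr_fun ?_
    intro k
    rw [Nat.factorial_succ]
    push_cast
    rw [show m + 1 + (k + 1 : ℝ) = m + 2 + k by ring]
    have : 0 < Real.Gamma (m + 2 + k) := Real.Gamma_pos_of_pos (by positivity)
    rw [pow_succ]
    field_simp
  refine h1.hasSum.unique (((h2.hasSum.mul_left m).add h4).congr_fun ?_)
  intro k
  have hk : 0 < m + (k : ℝ) := by positivity
  have : 0 < Real.Gamma (m + k) := Real.Gamma_pos_of_pos hk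
  rw [show m + 1 + (k : ℝ) = m + k + 1 by ring, Real.Gamma_add_one hk.ne']
  field_simp

def KK (m s a t : ℝ) : ℝ := Real.exp (-(a ^ 2 + t ^ 2) / 2) * t ^ s * hS m (a ^ 2 * t ^ 2 / 4)

lemma KK_deriv_a (m s a t : ℝ) (hm : 0 < m) (ht : 0 < t) :
    HasDerivAt (fun a => KK m s a t) (-a * KK m s a t + a / 2 * KK (m + 1) (s + 2) a t) a := by
  have h1 : HasDerivAt (fun a : ℝ => -(a ^ 2 + t ^ 2) / 2) (-a) a := by
    refine ((((hasDerivAt_pow 2 a).add_const (t ^ 2)).neg).div_const 2).congr_deriv ?_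
    push_cast; ring
  have h2 : HasDerivAt (fun a : ℝ => a ^ 2 * t ^ 2 / 4) (a * t ^ 2 / 2) a := by
    refine (((hasDerivAt_pow 2 a).mul_const (t ^ 2)).div_const 4).congr_deriv ?_
    push_cast; ring
  have h3 := (hS_deriv m hm (a ^ 2 * t ^ 2 / 4)).comp a h2
  refine ((h1.exp.mul_const (t ^ s)).mul h3).congr_deriv ?_
  have : t ^ (s + 2) = t ^ s * t ^ 2 := by rw [Real.rpow_add ht]; norm_num
  simp only [KK, this, Function.comp, Pi.mul_apply]
  ring

lemma KK_deriv_t (m s a t : ℝ) (hm : 0 < m) (ht : 0 < t) :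
    HasDerivAt (fun t => KK m s a t) (-KK m (s + 1) a t + s * KK m (s - 1) a t
      + a ^ 2 / 2 * KK (m + 1) (s + 1) a t) t := by
  have h1 : HasDerivAt (fun t : ℝ => -(a ^ 2 + t ^ 2) / 2) (-t) t := by
    refine ((((hasDerivAt_pow 2 t).const_add (a ^ 2)).neg).div_const 2).congr_deriv ?_
    push_cast; ring
  have h2 : HasDerivAt (fun t : ℝ => a ^ 2 * t ^ 2 / 4) (a ^ 2 * t / 2) t := by
    refine (((hasDerivAt_pow 2 t).const_mul (a ^ 2)).div_const 4).congr_deriv ?_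
    push_cast; ring
  have h3 := (hS_deriv m hm (a ^ 2 * t ^ 2 / 4)).comp t h2
  refine ((h1.exp.mul (Real.hasDerivAt_rpow_const (p := s) (Or.inl ht.ne'))).mul h3).congr_deriv ?_
  have : t ^ (s + 1) = t ^ s * t := by rw [Real.rpow_add ht]; norm_num
  simp only [KK, this, Function.comp, Pi.mul_apply]
  ring

lemma KK_rec (m s a t : ℝ) (hm : 0 < m) (ht : 0 < t) :
    KK m s a t = m * KK (m + 1) s a t + a ^ 2 / 4 * KK (m + 2) (s + 2) a t := by
  have : t ^ (s + 2) = t ^ s * t ^ 2 := by rw [Real.rpow_add ht]; norm_num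
  simp only [KK, this]
  rw [hS_rec m hm]
  ring

lemma KK_bound (m s A : ℝ) (hm : 0 < m) : ∃ C > 0, ∀ a, |a| ≤ A → ∀ t > 0,
    ‖KK m s a t‖ ≤ C * (t ^ s * Real.exp (-(1 / 4) * t ^ 2)) := by
  obtain ⟨C, hC, h⟩ := hS_bound m hm (1 / (A ^ 2 + 1)) (by positivity)
  refine ⟨C, hC, fun a ha t ht => ?_⟩
  have ha2 : a ^ 2 ≤ A ^ 2 := by
    rw [← sq_abs a]; gcongr
  have h0 := hS_nonneg m hm (a ^ 2 * t ^ 2 / 4) (by positivity)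
  rw [KK, Real.norm_of_nonneg (by positivity)]
  have h5 := h (a ^ 2 * t ^ 2 / 4) (by positivity)
  have h6 : 1 / (A ^ 2 + 1) * (a ^ 2 * t ^ 2 / 4) ≤ 1 / 4 * t ^ 2 := by
    rw [one_div, inv_mul_le_iff₀ (by positivity)]
    nlinarith [sq_nonneg t, mul_nonneg (sub_nonneg.2 ha2) (sq_nonneg t)]
  calc _ ≤ Real.exp (-(a ^ 2 + t ^ 2) / 2) * t ^ s * (C * Real.exp (1 / (A ^ 2 + 1) * (a ^ 2 * t ^ 2 / 4))) := by gcongr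
    _ = C * (t ^ s * Real.exp (-(a ^ 2 + t ^ 2) / 2 + 1 / (A ^ 2 + 1) * (a ^ 2 * t ^ 2 / 4))) := by
      rw [Real.exp_add]; ring
    _ ≤ _ := by
      gcongr
      nlinarith [sq_nonneg a]

lemma KK_cont (m s a : ℝ) (hm : 0 < m) : ContinuousOn (KK m s a) (Set.Ioi 0) :=
  fun t ht => (KK_deriv_t m s a t hm ht).continuousAt.continuousWithinAt

lemma KK_meas (m s a b : ℝ) (hm : 0 < m) (hb : 0 ≤ b) :
    AEStronglyMeasurable (KK m s a) (volume.restrict (Set.Ioi b)) :=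
  ((KK_cont m s a hm).mono (Set.Ioi_subset_Ioi hb)).aestronglyMeasurable measurableSet_Ioi

lemma KK_int (m s a b : ℝ) (hm : 0 < m) (hs : -1 < s) (hb : 0 ≤ b) :
    IntegrableOn (KK m s a) (Set.Ioi b) := by
  obtain ⟨C, hC, h⟩ := KK_bound m s |a| hm
  refine Integrable.mono' (((integrableOn_rpow_mul_exp_neg_mul_sq (b := 1 / 4) (by norm_num) hs).mono_set
    (Set.Ioi_subset_Ioi hb)).const_mul C) (KK_meas m s a b hm hb) ?_
  filter_upwards [ae_restrict_mem measurableSet_Ioi] with t ht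
  exact h a le_rfl t (lt_of_le_of_lt hb ht)

lemma bessel_eq (m c a t : ℝ) (ha : 0 < a) (ht : 0 < t) :
    t ^ c / a ^ (m - 1) * Real.exp (-(a ^ 2 + t ^ 2) / 2) * besselI (m - 1) (a * t)
      = 2 ^ (1 - m) * KK m (c + m - 1) a t := by
  have h1 : besselI (m - 1) (a * t) = (a * t / 2) ^ (m - 1) * hS m (a ^ 2 * t ^ 2 / 4) := by
    rw [besselI, hS, ← tsum_mul_left]
    refine tsum_congr fun k => ?_
    rw [Real.rpow_add (by positivity), show (2 * (k : ℝ)) = ((2 * k : ℕ) : ℝ) by push_cast; ring,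
      Real.rpow_natCast, pow_mul, show m - 1 + (k : ℝ) + 1 = m + k by ring,
      show (a * t / 2) ^ 2 = a ^ 2 * t ^ 2 / 4 by ring, mul_div_assoc]
  rw [h1, KK, Real.div_rpow (by positivity) (by positivity), Real.mul_rpow ha.le ht.le,
    show c + m - 1 = c + (m - 1) by ring, Real.rpow_add ht, show 1 - m = -(m - 1) by ring,
    Real.rpow_neg (by positivity)]
  have := Real.rpow_pos_of_pos ha (m - 1)
  field_simp

lemma marcumQ_eq (m a b : ℝ) (ha : 0 < a) (hb : 0 ≤ b) :
    marcumQ m a b = 2 ^ (1 - m) * ∫ t in Set.Ioi b, KK m (2 * m - 1) a t := by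
  rw [marcumQ, if_neg ha.ne', ← integral_const_mul]
  refine setIntegral_congr_fun measurableSet_Ioi fun t ht => ?_
  have := bessel_eq m m a t ha (lt_of_le_of_lt hb ht)
  rw [show m + m - 1 = 2 * m - 1 by ring] at this
  exact this

lemma deriv_b (m a b : ℝ) (hm : 0 < m) (hb : 0 < b) :
    HasDerivAt (fun b => ∫ t in Set.Ioi b, KK m (2 * m - 1) a t) (-KK m (2 * m - 1) a b) b := by
  have hi := KK_int m (2 * m - 1) a 0 hm (by linarith) le_rfl
  have hii : ∀ c ≥ 0, IntervalIntegrable (KK m (2 * m - 1) a) volume 0 c := fun c hc =>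
    (intervalIntegrable_iff_integrableOn_Ioc_of_le hc).2 (hi.mono_set Set.Ioc_subset_Ioi_self)
  have h := intervalIntegral.integral_hasDerivAt_right (hii b hb.le)
    ((KK_cont m (2 * m - 1) a hm).stronglyMeasurableAtFilter isOpen_Ioi b hb)
    ((KK_cont m (2 * m - 1) a hm).continuousAt (Ioi_mem_nhds hb))
  refine (h.const_sub (∫ t in Set.Ioi 0, KK m (2 * m - 1) a t)).congr_of_eventuallyEq ?_
  filter_upwards [Ioi_mem_nhds hb] with c hc
  have hc' : (0 : ℝ) < c := hc
  rw [intervalIntegral.integral_of_le hc'.le, ← Set.Ioc_union_Ioi_eq_Ioi hc'.le,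
    setIntegral_union (Set.Ioc_disjoint_Ioi le_rfl) measurableSet_Ioi
      (hi.mono_set Set.Ioc_subset_Ioi_self) (hi.mono_set (Set.Ioi_subset_Ioi hc'.le))]
  ring

lemma deriv_a (m a b : ℝ) (hm : 0 < m) (hb : 0 < b) :
    HasDerivAt (fun a => ∫ t in Set.Ioi b, KK m (2 * m - 1) a t)
      (a / 2 * KK (m + 1) (2 * m) a b) a := by
  have hi1 := KK_int m (2 * m - 1) a b hm (by linarith) hb.le
  have hi2 := KK_int (m + 1) (2 * m - 1 + 2) a b (by linarith) (by linarith) hb.le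
  have hi3 := KK_int (m + 1) (2 * m) a b (by linarith) (by linarith) hb.le
  obtain ⟨C1, hC1, h1⟩ := KK_bound m (2 * m - 1) (|a| + 1) hm
  obtain ⟨C2, hC2, h2⟩ := KK_bound (m + 1) (2 * m - 1 + 2) (|a| + 1) (by linarith)
  have hint : ∀ s : ℝ, -1 < s → IntegrableOn (fun t : ℝ => t ^ s * Real.exp (-(1 / 4) * t ^ 2)) (Set.Ioi b) :=
    fun s hs => (integrableOn_rpow_mul_exp_neg_mul_sq (b := 1 / 4) (by norm_num) hs).mono_set
      (Set.Ioi_subset_Ioi hb.le)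
  have key := hasDerivAt_integral_of_dominated_loc_of_deriv_le (μ := volume.restrict (Set.Ioi b))
    (F := fun a t => KK m (2 * m - 1) a t) (x₀ := a) (s := Metric.ball a 1)
    (F' := fun a t => -a * KK m (2 * m - 1) a t + a / 2 * KK (m + 1) (2 * m - 1 + 2) a t)
    (bound := fun t => (|a| + 1) * (C1 * (t ^ (2 * m - 1) * Real.exp (-(1 / 4) * t ^ 2)))
      + (|a| + 1) / 2 * (C2 * (t ^ (2 * m - 1 + 2) * Real.exp (-(1 / 4) * t ^ 2))))
    (Metric.ball_mem_nhds a one_pos)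
    (Filter.Eventually.of_forall fun x => KK_meas m (2 * m - 1) x b hm hb.le) hi1
    ((hi1.const_mul _).add (hi2.const_mul _)).aestronglyMeasurable ?_
    ((((hint _ (by linarith)).const_mul _).const_mul _).add
      (((hint _ (by linarith)).const_mul _).const_mul _)) ?_
  · refine key.2.congr_deriv ?_
    have hd : ∀ t > 0, HasDerivAt (fun t => -(a / 2) * KK (m + 1) (2 * m) a t)
        (-a * KK m (2 * m - 1) a t + a / 2 * KK (m + 1) (2 * m - 1 + 2) a t) t := by
      intro t ht
      refine ((KK_deriv_t (m + 1) (2 * m) a t (by linarith) ht).const_mul (-(a / 2))).congr_deriv ?_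
      rw [KK_rec m (2 * m - 1) a t hm ht, show m + 1 + 1 = m + 2 by ring,
        show 2 * m - 1 + 2 = 2 * m + 1 by ring]
      ring
    have hT := tendsto_zero_of_hasDerivAt_of_integrableOn_Ioi (a := b)
      (fun t ht => hd t (hb.trans ht)) key.1 (hi3.const_mul _)
    rw [integral_Ioi_of_hasDerivAt_of_tendsto' (fun t ht => hd t (lt_of_lt_of_le hb ht)) key.1 hT]
    ring
  · filter_upwards [ae_restrict_mem measurableSet_Ioi] with t ht x hx
    have hx' : |x| ≤ |a| + 1 := by
      rw [Metric.mem_ball, Real.dist_eq] at hx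
      have := abs_sub_abs_le_abs_sub x a
      linarith
    have ht' : 0 < t := hb.trans ht
    refine (norm_add_le _ _).trans ?_
    rw [norm_mul, norm_mul, norm_neg, norm_div, Real.norm_two, Real.norm_eq_abs x]
    have e1 := h1 x hx' t ht'
    have e2 := h2 x hx' t ht'
    gcongr
  · filter_upwards [ae_restrict_mem measurableSet_Ioi] with t ht x _
    exact KK_deriv_a m (2 * m - 1) x t hm (hb.trans ht)

/-- Derivatives of the Marcum Q-function: for `m > 0`,
`∂Q_m(a,b)/∂a = (b^m/a^{m−1})·e^{−(a²+b²)/2}·I_m(ab)` and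
`∂Q_m(a,b)/∂b = −(b^m/a^{m−1})·e^{−(a²+b²)/2}·I_{m−1}(ab)` for `a, b > 0`. -/
theorem marcumQ_derivatives (m : ℝ) (hm : 0 < m) :
    (∀ b > (0 : ℝ), ∀ a > (0 : ℝ),
        HasDerivAt (fun a' => marcumQ m a' b)
          (b ^ m / a ^ (m - 1) * Real.exp (-(a ^ 2 + b ^ 2) / 2) * besselI m (a * b)) a) ∧
      ∀ a > (0 : ℝ), ∀ b > (0 : ℝ),
        HasDerivAt (fun b' => marcumQ m a b')
          (-(b ^ m / a ^ (m - 1) * Real.exp (-(a ^ 2 + b ^ 2) / 2) *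
            besselI (m - 1) (a * b))) b := by
  refine ⟨fun b hb a ha => ?_, fun a ha b hb => ?_⟩
  · have h := ((deriv_a m a b hm hb).const_mul (2 ^ (1 - m))).congr_of_eventuallyEq
      (f₁ := fun a' => marcumQ m a' b) (by
        filter_upwards [Ioi_mem_nhds ha] with x hx using marcumQ_eq m x b hx hb.le)
    refine h.congr_deriv ?_
    have e := bessel_eq (m + 1) m a b ha hb
    rw [show m + 1 - 1 = m by ring, show m + (m + 1) - 1 = 2 * m by ring,
      show (1 : ℝ) - (m + 1) = (1 - m) - 1 by ring, Real.rpow_sub_one (by norm_num)] at e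
    have ea : a ^ m = a ^ (m - 1) * a := by rw [Real.rpow_sub_one ha.ne']; field_simp
    have := Real.rpow_pos_of_pos ha (m - 1)
    calc _ = a * (2 ^ (1 - m) / 2 * KK (m + 1) (2 * m) a b) := by ring
      _ = _ := by rw [← e, ea]; field_simp
  · have h := ((deriv_b m a b hm hb).const_mul (2 ^ (1 - m))).congr_of_eventuallyEq
      (f₁ := fun b' => marcumQ m a b') (by
        filter_upwards [Ioi_mem_nhds hb] with x hx using marcumQ_eq m a x ha (le_of_lt hx))
    refine h.congr_deriv ?_
    rw [bessel_eq m m a b ha hb, show m + m - 1 = 2 * m - 1 by ring]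
    ring

end
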